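/- Suppose S is a primitive sequence with curling number k > 1 which is not robust. Then there exist sequences X and T such that S = X(TX)^k and T is a proper suffix of S. -/

import Mathlib

/-- `listPow Y k` is the sequence `Y` repeated `k` times (i.e. `Y^k`). -/
def listPow {α : Type*} (Y : List α) : ℕ → List α
  | 0 => []
  | k + 1 => Y ++ listPow Y k

/-- The curling number of a finite sequence `S`: the largest `k` such that
`S = X ++ Y^k` for some (possibly empty) `X` and nonempty `Y`. -/
noncomputable def CN {α : Type*} (S : List α) : ℕ :=
  sSup {k | ∃ X Y : List α, Y ≠ [] ∧ S = X ++ listPow Y k}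

/-- A nonempty sequence is primitive if it is not a power `T^i` with `i ≥ 2`. -/
def Primitive {α : Type*} (S : List α) : Prop :=
  S ≠ [] ∧ ∀ (T : List α) (i : ℕ), 2 ≤ i → S ≠ listPow T i

/-- `T` is a proper suffix of `S`: a suffix which is strictly shorter than `S`. -/
def ProperSuffix {α : Type*} (T S : List α) : Prop := T <:+ S ∧ T.length < S.length

/-- A sequence `S` with curling number `k` is robust if no proper suffix of
`S^(k+1)` has curling number `≥ k + 1`. -/
def Robust {α : Type*} (S : List α) : Prop :=
  ∀ T : List α, ProperSuffix T (listPow S (CN S + 1)) → CN T ≤ CN S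

section listPow

variable {α : Type*}

theorem listPow_add (Y : List α) (m n : ℕ) :
    listPow Y (m + n) = listPow Y m ++ listPow Y n := by
  induction m with
  | zero => simp [listPow]
  | succ m ih => rw [Nat.succ_add, listPow, listPow, ih, List.append_assoc]

theorem listPow_one (Y : List α) : listPow Y 1 = Y := by simp [listPow]

theorem listPow_succ' (Y : List α) (n : ℕ) : listPow Y (n + 1) = listPow Y n ++ Y := by
  rw [listPow_add, listPow_one]

theorem length_listPow (Y : List α) (n : ℕ) : (listPow Y n).length = n * Y.length := by
  induction n with
  | zero => simp [listPow]
  | succ n ih => rw [listPow, List.length_append, ih]; ring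

theorem listPow_suffix_listPow (Y : List α) {m n : ℕ} (h : m ≤ n) :
    listPow Y m <:+ listPow Y n := by
  obtain ⟨d, rfl⟩ := Nat.exists_eq_add_of_le' h
  exact ⟨listPow Y d, (listPow_add Y d m).symm⟩

/-- Two commuting words are powers of a common word. -/
theorem exists_listPow_of_append_comm (A B : List α) (h : A ++ B = B ++ A) :
    ∃ (R : List α) (i j : ℕ), A = listPow R i ∧ B = listPow R j := by
  induction hn : A.length + B.length using Nat.strong_induction_on generalizing A B with
  | _ n ih =>
    wlog hAB : A.length ≤ B.length generalizing A B
    · obtain ⟨R, i, j, hi, hj⟩ := this B A h.symm (by omega) (by omega)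
      exact ⟨R, j, i, hj, hi⟩
    rcases eq_or_ne A [] with rfl | hA
    · exact ⟨B, 0, 1, rfl, (listPow_one B).symm⟩
    obtain ⟨C, rfl⟩ : A <+: B :=
      List.prefix_of_prefix_length_le (List.prefix_append A B) ⟨A, h.symm⟩ hAB
    have hpos := List.length_pos_iff.mpr hA
    rw [List.append_assoc] at h
    have hlen : A.length + C.length < n := by
      rw [List.length_append] at hn; omega
    obtain ⟨R, i, j, hi, hj⟩ := ih _ hlen A C (List.append_cancel_left h) rfl
    exact ⟨R, i, i + j, hi, by rw [listPow_add, ← hi, ← hj]⟩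

theorem Primitive.eq_nil_of_append_comm {S Z : List α} (hS : Primitive S)
    (h : S ++ Z = Z ++ S) (hlen : Z.length < S.length) : Z = [] := by
  obtain ⟨R, i, j, hi, hj⟩ := exists_listPow_of_append_comm S Z h
  have hi2 : i < 2 := by
    by_contra hc
    exact hS.2 R i (by omega) hi
  interval_cases i
  · exact absurd hi hS.1
  · rw [listPow_one] at hi
    subst hi
    rcases j with _ | j
    · exact hj
    · rw [hj, length_listPow, Nat.succ_mul] at hlen
      omega

theorem le_CN {S Y : List α} {m : ℕ} (hY : Y ≠ []) (h : listPow Y m <:+ S) : m ≤ CN S := by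
  refine le_csSup ⟨S.length, ?_⟩ ?_
  · rintro n ⟨X, Y, hY, rfl⟩
    rw [List.length_append, length_listPow]
    have := Nat.le_mul_of_pos_right n (List.length_pos_iff.mpr hY)
    omega
  · obtain ⟨X, hX⟩ := h
    exact ⟨X, Y, hY, hX.symm⟩

theorem exists_listPow_suffix_of_lt_CN {T : List α} {m : ℕ} (h : m < CN T) :
    ∃ Y : List α, Y ≠ [] ∧ listPow Y (m + 1) <:+ T := by
  have hne : {k | ∃ X Y : List α, Y ≠ [] ∧ T = X ++ listPow Y k}.Nonempty := by
    by_contra hc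
    rw [Set.not_nonempty_iff_eq_empty] at hc
    rw [CN, hc] at h
    simp at h
  obtain ⟨n, ⟨X, Y, hY, hT⟩, hn⟩ := exists_lt_of_lt_csSup hne h
  exact ⟨Y, hY, (listPow_suffix_listPow Y hn).trans ⟨X, hT.symm⟩⟩

end listPow

/-- If `S` is a primitive sequence with curling number `k > 1` which is not robust, then
`S = X (T X)^k` for some `X` and some proper suffix `T` of `S`. -/
theorem thSick2 {α : Type*} (S : List α) (k : ℕ) (hP : Primitive S) (hk : CN S = k)
    (hk1 : 1 < k) (hR : ¬ Robust S) :
    ∃ X T : List α, S = X ++ listPow (T ++ X) k ∧ ProperSuffix T S := by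
  unfold Robust at hR
  push Not at hR
  obtain ⟨U, ⟨hU, hUlen⟩, hCN⟩ := hR
  rw [hk] at hU hUlen hCN
  obtain ⟨Z, hZ, hZU⟩ := exists_listPow_suffix_of_lt_CN hCN
  have hZS := hZU.trans hU
  have hlen : Z.length < S.length := by
    have := hZU.length_le
    rw [length_listPow] at this hUlen
    exact lt_of_mul_lt_mul_left (this.trans_lt hUlen) (Nat.zero_le _)
  have hS1 : S <:+ listPow S (k + 1) := by
    simpa [listPow_one] using listPow_suffix_listPow S (show 1 ≤ k + 1 by omega)
  have hSZ : S <:+ listPow Z (k + 1) := by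
    refine (List.suffix_or_suffix_of_suffix hS1 hZS).resolve_right fun h => ?_
    have := le_CN hZ h
    omega
  have hZk : listPow Z k <:+ listPow Z (k + 1) := listPow_suffix_listPow Z (by omega)
  rcases List.suffix_or_suffix_of_suffix hSZ hZk with h | ⟨X, hX⟩
  · refine absurd (hP.eq_nil_of_append_comm ?_ hlen) hZ
    have h1 : S ++ Z <:+ listPow S (k + 1) := by
      refine List.IsSuffix.trans ?_ hZS
      obtain ⟨W, hW⟩ := h
      exact ⟨W, by rw [listPow_succ', ← hW, List.append_assoc]⟩
    have hZ1 : Z <:+ S := by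
      have hZ1 : Z <:+ listPow S (k + 1) :=
        List.IsSuffix.trans ⟨listPow Z k, (listPow_succ' Z k).symm⟩ hZS
      exact List.suffix_of_suffix_length_le hZ1 hS1 hlen.le
    have h2 : Z ++ S <:+ listPow S (k + 1) := by
      refine List.IsSuffix.trans ?_ (listPow_suffix_listPow S (show 2 ≤ k + 1 by omega))
      obtain ⟨W, hW⟩ := hZ1
      exact ⟨W, by rw [← List.append_assoc, hW]; simp [listPow]⟩
    refine (List.suffix_of_suffix_length_le h1 h2 ?_).eq_of_length ?_ <;>
      simp [Nat.add_comm]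
  · obtain ⟨T, hT⟩ := hSZ
    have hTX : T ++ X = Z := by
      rw [← hX, listPow, ← List.append_assoc] at hT
      exact List.append_cancel_right hT
    have hTlen : T.length < S.length := by
      rw [← hTX, List.length_append] at hlen
      omega
    refine ⟨X, T, by rw [hTX, hX], ?_, hTlen⟩
    obtain ⟨W, hW⟩ := hZS
    rw [← hT, ← List.append_assoc, listPow_succ'] at hW
    have hTS : T <:+ listPow S k := ⟨W, List.append_cancel_right hW⟩
    have hSk : S <:+ listPow S k := by
      simpa [listPow_one] using listPow_suffix_listPow S hk1.le
    exact List.suffix_of_suffix_length_le hTS hSk hTlen.le
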